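/- There are no integers a₁, a₂, a₃, b₁, b₂, b₃ satisfying simultaneously: (i) a₁² + b₁² + a₂² + b₂² + a₃² + b₃² = 8; (ii) (2a₁b₁ − b₁²) + (2a₂b₂ − b₂²) + (2a₃b₃ − b₃²) = 0; and (iii) |a₁a₂b₃ + a₁b₂a₃ + b₁a₂a₃ − a₁b₂b₃ − b₁a₂b₃ − b₁b₂a₃ + 2b₁b₂b₃| = 6. -/

import Mathlib

/-- Finite check on the box `[-2, 2]⁶`, to which the norm equation confines all solutions. -/
theorem abs_cubic_ne_six_of_mem_Icc :
    ∀ a₁ ∈ Finset.Icc (-2 : ℤ) 2, ∀ b₁ ∈ Finset.Icc (-2 : ℤ) 2,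
    ∀ a₂ ∈ Finset.Icc (-2 : ℤ) 2, ∀ b₂ ∈ Finset.Icc (-2 : ℤ) 2,
    ∀ a₃ ∈ Finset.Icc (-2 : ℤ) 2, ∀ b₃ ∈ Finset.Icc (-2 : ℤ) 2,
      a₁ ^ 2 + b₁ ^ 2 + a₂ ^ 2 + b₂ ^ 2 + a₃ ^ 2 + b₃ ^ 2 = 8 →
      (2 * a₁ * b₁ - b₁ ^ 2) + (2 * a₂ * b₂ - b₂ ^ 2) + (2 * a₃ * b₃ - b₃ ^ 2) = 0 →
      |a₁ * a₂ * b₃ + a₁ * b₂ * a₃ + b₁ * a₂ * a₃ - a₁ * b₂ * b₃ - b₁ * a₂ * b₃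
        - b₁ * b₂ * a₃ + 2 * b₁ * b₂ * b₃| ≠ 6 := by
  decide +kernel

theorem mem_Icc_neg_two_two_of_sq_le_eight {x : ℤ} (h : x ^ 2 ≤ 8) :
    x ∈ Finset.Icc (-2 : ℤ) 2 :=
  Finset.mem_Icc.2 ⟨by nlinarith, by nlinarith⟩


/-- There are no integers `a₁, a₂, a₃, b₁, b₂, b₃` satisfying simultaneously:
(i) `a₁² + b₁² + a₂² + b₂² + a₃² + b₃² = 8`;
(ii) `(2a₁b₁ − b₁²) + (2a₂b₂ − b₂²) + (2a₃b₃ − b₃²) = 0`;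
(iii) `|a₁a₂b₃ + a₁b₂a₃ + b₁a₂a₃ − a₁b₂b₃ − b₁a₂b₃ − b₁b₂a₃ + 2b₁b₂b₃| = 6`. -/
theorem stmt4 :
    ¬ ∃ a₁ a₂ a₃ b₁ b₂ b₃ : ℤ,
      a₁ ^ 2 + b₁ ^ 2 + a₂ ^ 2 + b₂ ^ 2 + a₃ ^ 2 + b₃ ^ 2 = 8 ∧
      (2 * a₁ * b₁ - b₁ ^ 2) + (2 * a₂ * b₂ - b₂ ^ 2) + (2 * a₃ * b₃ - b₃ ^ 2) = 0 ∧
      |a₁ * a₂ * b₃ + a₁ * b₂ * a₃ + b₁ * a₂ * a₃ - a₁ * b₂ * b₃ - b₁ * a₂ * b₃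
        - b₁ * b₂ * a₃ + 2 * b₁ * b₂ * b₃| = 6 := by
  rintro ⟨a₁, a₂, a₃, b₁, b₂, b₃, h₁, h₂, h₃⟩
  refine abs_cubic_ne_six_of_mem_Icc a₁ ?_ b₁ ?_ a₂ ?_ b₂ ?_ a₃ ?_ b₃ ?_ h₁ h₂ h₃ <;>
    apply mem_Icc_neg_two_two_of_sq_le_eight <;>
    linarith [sq_nonneg a₁, sq_nonneg a₂, sq_nonneg a₃, sq_nonneg b₁, sq_nonneg b₂, sq_nonneg b₃]
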